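/- Let 1<p<∞ and let w be a weight on ℝⁿ belonging to the strong Muckenhoupt class A_p^{(s)}(ℝⁿ) (equivalently, w ∈ A_p(x_i) for each i = 1,…,n). Then there exists a constant c depending only on n and p such that the strong Hardy–Littlewood maximal operator satisfies ‖M^{(s)}f‖_{L^p_w(ℝⁿ)} ≤ c (∏_{i=1}^n ‖w‖_{A_p(x_i)})^{1/(p-1)} ‖f‖_{L^p_w(ℝⁿ)} for all f ∈ L^p_w(ℝⁿ). Moreover the power 1/(p-1) is sharp: for n = 2 and w(x₁,x₂) = |x₁|^{(1-ε)(p-1)}|x₂|^{(1-ε)(p-1)} with ε ∈ (0,1), one has (‖w‖_{A_p(x_1)}‖w‖_{A_p(x_2)})^{1/(p-1)} ≍ ε^{-2} and there exists f ∈ L^p_w with ‖M^{(s)}f‖_{L^p_w} ≥ c ε^{-2} ‖f‖_{L^p_w}. -/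

import Mathlib

open MeasureTheory Set Filter
open scoped ENNReal

noncomputable section

/-- `∫_a^b w` as a lower integral. -/
def lintIoc (w : ℝ → ℝ) (a b : ℝ) : ℝ≥0∞ :=
  ∫⁻ t in Set.Ioc a b, ENNReal.ofReal (w t)

/-- Average `(1/(b-a)) ∫_a^b w`. -/
def avgIoc (w : ℝ → ℝ) (a b : ℝ) : ℝ≥0∞ :=
  (ENNReal.ofReal (b - a))⁻¹ * lintIoc w a b

/-- The (two-sided) Muckenhoupt `A_p` characteristic of a function of one variable:
`sup_I ((1/|I|)∫_I u)((1/|I|)∫_I u^{1-p'})^{p-1}`, sup over bounded intervals. -/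
def apChar (p : ℝ) (u : ℝ → ℝ) : ℝ≥0∞ :=
  ⨆ (a : ℝ) (b : ℝ) (_ : a < b),
    avgIoc u a b * avgIoc (fun t => u t ^ (1 - p / (p - 1))) a b ^ (p - 1)

/-- `A_p` characteristic of `w : ℝⁿ → ℝ` in the `i`-th variable, uniformly
(essential supremum) with respect to the remaining variables. -/
def apVar {n : ℕ} (p : ℝ) (w : (Fin n → ℝ) → ℝ) (i : Fin n) : ℝ≥0∞ :=
  essSup (fun x : Fin n → ℝ => apChar p (fun t => w (Function.update x i t)))
    MeasureTheory.volume

/-- A weight on `ℝⁿ`: a.e. positive and locally integrable. -/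
def IsWeightN {n : ℕ} (w : (Fin n → ℝ) → ℝ) : Prop :=
  (∀ᵐ x : Fin n → ℝ, 0 < w x) ∧ MeasureTheory.LocallyIntegrable w MeasureTheory.volume

/-- Weighted `L^p(ℝⁿ)` "norm" `(∫ g^p w)^{1/p}` of an `ℝ≥0∞`-valued function. -/
def lnormWN {n : ℕ} (p : ℝ) (w : (Fin n → ℝ) → ℝ) (g : (Fin n → ℝ) → ℝ≥0∞) : ℝ≥0∞ :=
  (∫⁻ x : Fin n → ℝ, g x ^ p * ENNReal.ofReal (w x)) ^ (1 / p)

/-- The strong Hardy–Littlewood maximal operator on `ℝⁿ`: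
`M^{(s)}f(x) = sup_{P ∋ x} (1/|P|) ∫_P |f|`, sup over axes-parallel parallelepipeds. -/
def Ms {n : ℕ} (f : (Fin n → ℝ) → ℝ) (x : Fin n → ℝ) : ℝ≥0∞ :=
  ⨆ (a : Fin n → ℝ) (b : Fin n → ℝ) (_ : ∀ i, a i < b i)
    (_ : ∀ i, x i ∈ Set.Icc (a i) (b i)),
    (∏ i, ENNReal.ofReal (b i - a i))⁻¹ *
      ∫⁻ y in Set.univ.pi (fun i => Set.Ioc (a i) (b i)), ENNReal.ofReal |f y|


def Iq (q : ℚ × ℚ) : Set ℝ := Set.Ioc (q.1 : ℝ) (q.2 : ℝ)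

lemma Iq_meas (q : ℚ × ℚ) : MeasurableSet (Iq q) := measurableSet_Ioc

lemma covering (S : Finset (ℚ × ℚ)) : ∃ T ⊆ S, (⋃ q ∈ T, Iq q) = (⋃ q ∈ S, Iq q) ∧
    ∀ x : ℝ, ∑ q ∈ T, (Iq q).indicator (fun _ => (1 : ℝ≥0∞)) x ≤
      2 * (⋃ q ∈ T, Iq q).indicator (fun _ => (1 : ℝ≥0∞)) x := by
  classical
  obtain ⟨T, hT, hmin⟩ := Finset.exists_min_image
    (S.powerset.filter (fun T => (⋃ q ∈ T, Iq q) = (⋃ q ∈ S, Iq q))) Finset.card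
    ⟨S, by simp⟩
  simp only [Finset.mem_filter, Finset.mem_powerset] at hT hmin
  refine ⟨T, hT.1, hT.2, fun x => ?_⟩
  have h1 : ∑ q ∈ T, (Iq q).indicator (fun _ => (1 : ℝ≥0∞)) x
      = ((T.filter (fun q => x ∈ Iq q)).card : ℝ≥0∞) := by
    rw [Finset.card_filter]
    push_cast
    refine Finset.sum_congr rfl fun q _ => ?_
    simp [Set.indicator_apply]
  rw [h1]
  by_cases hx : x ∈ ⋃ q ∈ T, Iq q
  · rw [Set.indicator_of_mem hx]
    have : (T.filter (fun q => x ∈ Iq q)).card ≤ 2 := by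
      by_contra hc
      push Not at hc
      set F := T.filter (fun q => x ∈ Iq q) with hF
      have hne : F.Nonempty := Finset.card_pos.1 (by omega)
      obtain ⟨q1, hq1, hm1⟩ := Finset.exists_min_image F (fun q => q.1) hne
      obtain ⟨q2, hq2, hm2⟩ := Finset.exists_max_image F (fun q => q.2) hne
      have : ∃ q3 ∈ F, q3 ∉ ({q1, q2} : Finset (ℚ × ℚ)) := by
        by_contra hh
        push Not at hh
        have := Finset.card_le_card (show F ⊆ {q1, q2} from hh)
        have h2 : ({q1, q2} : Finset (ℚ × ℚ)).card ≤ 2 := Finset.card_le_two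
        omega
      obtain ⟨q3, hq3, hn⟩ := this
      simp only [Finset.mem_insert, Finset.mem_singleton, not_or] at hn
      have e1 := hm1 q3 hq3
      have e2 := hm2 q3 hq3
      simp only [hF, Finset.mem_filter, Iq, Set.mem_Ioc] at hq1 hq2 hq3
      have hun : (⋃ q ∈ T.erase q3, Iq q) = (⋃ q ∈ S, Iq q) := by
        rw [← hT.2]
        apply Set.Subset.antisymm
        · exact Set.biUnion_subset_biUnion_left (by intro q hq; exact Finset.mem_of_mem_erase hq)
        · intro t ht
          simp only [Set.mem_iUnion, exists_prop] at ht ⊢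
          obtain ⟨q, hq, htq⟩ := ht
          by_cases hqq : q = q3
          · subst hqq
            have e1' : (q1.1 : ℝ) ≤ q.1 := by exact_mod_cast e1
            have e2' : (q.2 : ℝ) ≤ q2.2 := by exact_mod_cast e2
            simp only [Iq, Set.mem_Ioc] at htq
            rcases le_total t x with h | h
            · exact ⟨q1, Finset.mem_erase.2 ⟨Ne.symm hn.1, hq1.1⟩, by
                constructor <;> linarith [hq1.2.1, hq1.2.2, htq.1, htq.2]⟩
            · exact ⟨q2, Finset.mem_erase.2 ⟨Ne.symm hn.2, hq2.1⟩, by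
                constructor <;> linarith [hq2.2.1, hq2.2.2, htq.1, htq.2]⟩
          · exact ⟨q, Finset.mem_erase.2 ⟨hqq, hq⟩, htq⟩
      have := hmin (T.erase q3) ⟨(Finset.erase_subset _ _).trans hT.1, hun⟩
      have h3 := Finset.card_erase_lt_of_mem hq3.1
      omega
    simp only [mul_one]
    exact_mod_cast this
  · have : T.filter (fun q => x ∈ Iq q) = ∅ := by
      apply Finset.filter_eq_empty_iff.2
      intro q hq hxq
      exact hx (Set.mem_biUnion hq hxq)
    simp [this]

def Mmu (μ : Measure ℝ) (h : ℝ → ℝ≥0∞) (x : ℝ) : ℝ≥0∞ :=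
  ⨆ q : ℚ × ℚ, (Iq q).indicator (fun _ => (∫⁻ t in Iq q, h t ∂μ) / μ (Iq q)) x

lemma Mmu_meas (μ : Measure ℝ) (h : ℝ → ℝ≥0∞) : Measurable (Mmu μ h) :=
  Measurable.iSup fun q => measurable_const.indicator (Iq_meas q)

lemma le_Mmu (μ : Measure ℝ) (h : ℝ → ℝ≥0∞) {q : ℚ × ℚ} {x : ℝ} (hx : x ∈ Iq q) :
    (∫⁻ t in Iq q, h t ∂μ) / μ (Iq q) ≤ Mmu μ h x := by
  refine le_trans (le_of_eq ?_) (le_iSup _ q)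
  rw [Set.indicator_of_mem hx]

lemma finite_weak (μ ν : Measure ℝ) (c : ℝ≥0∞) (S : Finset (ℚ × ℚ))
    (hS : ∀ q ∈ S, c * μ (Iq q) ≤ ν (Iq q)) :
    c * μ (⋃ q ∈ S, Iq q) ≤ 2 * ν (⋃ q ∈ S, Iq q) := by
  obtain ⟨T, hTS, hU, hov⟩ := covering S
  have hm : MeasurableSet (⋃ q ∈ T, Iq q) := T.measurableSet_biUnion fun q _ => Iq_meas q
  rw [← hU]
  calc c * μ (⋃ q ∈ T, Iq q) ≤ c * ∑ q ∈ T, μ (Iq q) := by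
        gcongr; exact measure_biUnion_finset_le _ _
    _ = ∑ q ∈ T, c * μ (Iq q) := by rw [Finset.mul_sum]
    _ ≤ ∑ q ∈ T, ν (Iq q) := Finset.sum_le_sum fun q hq => hS q (hTS hq)
    _ = ∑ q ∈ T, ∫⁻ x, (Iq q).indicator (fun _ => (1 : ℝ≥0∞)) x ∂ν := by
        refine Finset.sum_congr rfl fun q _ => ?_
        rw [lintegral_indicator (Iq_meas q)]; simp
    _ = ∫⁻ x, ∑ q ∈ T, (Iq q).indicator (fun _ => (1 : ℝ≥0∞)) x ∂ν := by
        rw [lintegral_finsetSum]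
        intro q _; exact measurable_const.indicator (Iq_meas q)
    _ ≤ ∫⁻ x, 2 * (⋃ q ∈ T, Iq q).indicator (fun _ => (1 : ℝ≥0∞)) x ∂ν := lintegral_mono hov
    _ = 2 * ν (⋃ q ∈ T, Iq q) := by
        rw [lintegral_const_mul _ (measurable_const.indicator hm), lintegral_indicator hm]; simp

lemma weak11 (μ : Measure ℝ) [SFinite μ] (h : ℝ → ℝ≥0∞) (c : ℝ≥0∞) :
    c * μ {x | c < Mmu μ h x} ≤ 2 * ∫⁻ x, h x ∂μ := by
  classical
  let Q : Set (ℚ × ℚ) := {q | c < (∫⁻ t in Iq q, h t ∂μ) / μ (Iq q)}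
  have hset : {x | c < Mmu μ h x} = ⋃ q : ℚ × ℚ, (if q ∈ Q then Iq q else ∅) := by
    ext x
    simp only [Mmu, Set.mem_ofPred_eq, lt_iSup_iff, Set.mem_iUnion]
    refine exists_congr fun q => ?_
    by_cases hx : x ∈ Iq q <;> by_cases hq : q ∈ Q <;> simp [hx, hq] <;> simpa [Q] using hq
  have hset2 : {x | c < Mmu μ h x} =
      ⋃ F : Finset (ℚ × ℚ), ⋃ q ∈ F.filter (fun q => q ∈ Q), Iq q := by
    rw [hset]
    ext x
    simp only [Set.mem_iUnion, Finset.mem_filter, exists_prop]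
    constructor
    · rintro ⟨q, hq⟩
      by_cases h : q ∈ Q
      · rw [if_pos h] at hq
        exact ⟨{q}, q, ⟨by simp, h⟩, hq⟩
      · rw [if_neg h] at hq; exact absurd hq (by simp)
    · rintro ⟨F, q, ⟨-, h⟩, hx⟩
      exact ⟨q, by rw [if_pos h]; exact hx⟩
  rw [hset2, Directed.measure_iUnion, ENNReal.mul_iSup]
  · refine iSup_le fun F => ?_
    have := finite_weak μ (μ.withDensity h) c (F.filter (fun q => q ∈ Q)) ?_
    · refine this.trans ?_
      gcongr
      rw [withDensity_apply']
      exact setLIntegral_le_lintegral _ _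
    · intro q hq
      have hq' : c < (∫⁻ t in Iq q, h t ∂μ) / μ (Iq q) := (Finset.mem_filter.1 hq).2
      rw [withDensity_apply']
      exact ENNReal.mul_le_of_le_div hq'.le
  · intro F G
    refine ⟨F ∪ G, ?_, ?_⟩
    · exact Set.biUnion_subset_biUnion_left (by
        intro q hq; simp only [Finset.mem_filter, Finset.mem_union, SetLike.mem_coe] at *; tauto)
    · exact Set.biUnion_subset_biUnion_left (by
        intro q hq; simp only [Finset.mem_filter, Finset.mem_union, SetLike.mem_coe] at *; tauto)


lemma weak2 (μ : Measure ℝ) [SFinite μ] (h : ℝ → ℝ≥0∞) (hm : Measurable h) (c : ℝ≥0∞) (hc : c ≠ ∞) :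
    c * μ {x | c < Mmu μ h x} ≤ 4 * ∫⁻ x, (if c < 2 * h x then h x else 0) ∂μ := by
  set h1 : ℝ → ℝ≥0∞ := fun x => if c < 2 * h x then h x else 0 with hh1
  have hle : ∀ x, h x ≤ h1 x + c / 2 := by
    intro x
    simp only [hh1]
    split_ifs with hx
    · exact le_self_add
    · push Not at hx
      rw [zero_add]
      rw [ENNReal.le_div_iff_mul_le (by simp) (by simp), mul_comm]
      exact hx
  have hMle : ∀ x, Mmu μ h x ≤ Mmu μ h1 x + c / 2 := by
    intro x
    refine iSup_le fun q => ?_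
    by_cases hx : x ∈ Iq q
    · rw [Set.indicator_of_mem hx]
      refine le_trans ?_ (add_le_add_left (le_Mmu μ h1 hx) _)
      calc (∫⁻ t in Iq q, h t ∂μ) / μ (Iq q) 
          ≤ (∫⁻ t in Iq q, h1 t + c / 2 ∂μ) / μ (Iq q) := by
            gcongr; exact hle _
        _ = ((∫⁻ t in Iq q, h1 t ∂μ) + c / 2 * μ (Iq q)) / μ (Iq q) := by
            rw [lintegral_add_right _ measurable_const]; simp
        _ ≤ _ := by
            rw [ENNReal.add_div]
            exact add_le_add_right (ENNReal.div_le_of_le_mul le_rfl) _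
    · rw [Set.indicator_of_notMem hx]; exact zero_le
  have hsub : {x | c < Mmu μ h x} ⊆ {x | c / 2 < Mmu μ h1 x} := by
    intro x hx
    have h1' : c < Mmu μ h x := hx
    have h2 := h1'.trans_le (hMle x)
    by_contra hcon
    have hcon' : Mmu μ h1 x ≤ c / 2 := not_lt.1 hcon
    have : c < c / 2 + c / 2 := h2.trans_le (by gcongr)
    rw [ENNReal.add_halves] at this
    exact lt_irrefl _ this
  calc c * μ {x | c < Mmu μ h x} ≤ c * μ {x | c / 2 < Mmu μ h1 x} := by gcongr
    _ = 2 * (c / 2 * μ {x | c / 2 < Mmu μ h1 x}) := by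
        rw [← mul_assoc, ENNReal.mul_div_cancel (by simp) (by simp)]
    _ ≤ 2 * (2 * ∫⁻ x, h1 x ∂μ) := by gcongr 2 * ?_; exact weak11 _ _ _
    _ = _ := by rw [← mul_assoc]; norm_num

lemma layer_fin (q : ℝ) (hq : 0 < q) (r : ℝ) (hr : 0 ≤ r) :
    ∫⁻ t in Ioc (0:ℝ) r, ENNReal.ofReal (t ^ (q - 1)) = ENNReal.ofReal (r ^ q / q) := by
  rw [← ofReal_integral_eq_lintegral_ofReal]
  · rw [← intervalIntegral.integral_of_le hr, integral_rpow (Or.inl (by linarith))]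
    rw [sub_add_cancel, Real.zero_rpow hq.ne', sub_zero]
  · rw [← IntegrableOn, ← intervalIntegrable_iff_integrableOn_Ioc_of_le hr]
    exact intervalIntegral.intervalIntegrable_rpow' (by linarith)
  · filter_upwards [ae_restrict_mem measurableSet_Ioc] with t ht
    exact Real.rpow_nonneg ht.1.le _

lemma layer (q : ℝ) (hq : 0 < q) (y : ℝ≥0∞) :
    ∫⁻ t in Ioi (0:ℝ), (if ENNReal.ofReal t < y then ENNReal.ofReal (t ^ (q - 1)) else 0)
      = y ^ q / ENNReal.ofReal q := by
  have key : ∀ r : ℝ, 0 ≤ r → ∫⁻ t in Ioi (0:ℝ),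
      (if ENNReal.ofReal t < ENNReal.ofReal r then ENNReal.ofReal (t ^ (q - 1)) else 0)
      = ENNReal.ofReal r ^ q / ENNReal.ofReal q := by
    intro r hr
    rw [ENNReal.ofReal_rpow_of_nonneg hr hq.le, ← ENNReal.ofReal_div_of_pos hq,
      ← layer_fin q hq r hr, ← lintegral_indicator measurableSet_Ioi,
      ← lintegral_indicator measurableSet_Ioc]
    apply lintegral_congr_ae
    filter_upwards [(measure_eq_zero_iff_ae_notMem (s := {r})).1 (by simp)] with t ht
    have ht' : t ≠ r := ht
    by_cases h0 : 0 < t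
    · simp only [Set.indicator_apply, mem_Ioi, h0, mem_Ioc, true_and, if_true]
      by_cases htr : t < r
      · rw [if_pos, if_pos htr.le]
        exact (ENNReal.ofReal_lt_ofReal_iff (h0.trans htr)).2 htr
      · push Not at htr
        rw [if_neg (not_lt.2 (ENNReal.ofReal_le_ofReal htr)), if_neg]
        exact not_le.2 (lt_of_le_of_ne htr ht'.symm)
    · simp [Set.indicator_apply, h0]
  rcases eq_or_ne y ∞ with rfl | hy
  · rw [ENNReal.top_rpow_of_pos hq, ENNReal.top_div_of_ne_top (by simp)]
    refine ENNReal.eq_top_of_forall_nnreal_le fun s => ?_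
    obtain ⟨r, hr0, hr⟩ : ∃ r : ℝ, 0 ≤ r ∧ (s : ℝ≥0∞) = ENNReal.ofReal r ^ q / ENNReal.ofReal q := by
      refine ⟨(s * q) ^ (1/q), by positivity, ?_⟩
      rw [ENNReal.ofReal_rpow_of_nonneg (by positivity) hq.le, ← Real.rpow_mul (by positivity),
        one_div, inv_mul_cancel₀ hq.ne', Real.rpow_one, ← ENNReal.ofReal_div_of_pos hq,
        mul_div_cancel_right₀ _ hq.ne']
      simp
    rw [hr, ← key r hr0]
    refine lintegral_mono fun t => ?_
    simp only [ENNReal.ofReal_lt_top, if_true]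
    split_ifs <;> simp
  · have := key y.toReal ENNReal.toReal_nonneg
    rwa [ENNReal.ofReal_toReal hy] at this

lemma strong_type (p : ℝ) (hp : 1 < p) (μ : Measure ℝ) [SFinite μ] (h : ℝ → ℝ≥0∞)
    (hm : Measurable h) :
    ∫⁻ x, Mmu μ h x ^ p ∂μ ≤ ENNReal.ofReal (4 * p * 2 ^ (p - 1) / (p - 1)) * ∫⁻ x, h x ^ p ∂μ := by
  have hp0 : 0 < p := by linarith
  have hp1 : 0 < p - 1 := by linarith
  have hMm := Mmu_meas μ h
  have e1 : ∀ x, Mmu μ h x ^ p = ENNReal.ofReal p * ∫⁻ t in Ioi (0:ℝ),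
      (if ENNReal.ofReal t < Mmu μ h x then ENNReal.ofReal (t ^ (p - 1)) else 0) := by
    intro x
    rw [layer p hp0, ENNReal.mul_div_cancel (by simpa using hp0) (by simp)]
  have e2 : ∀ x, ∫⁻ t in Ioi (0:ℝ),
      (if ENNReal.ofReal t < 2 * h x then ENNReal.ofReal (t ^ (p - 1 - 1)) * h x else 0)
      = (2 * h x) ^ (p-1) / ENNReal.ofReal (p-1) * h x := by
    intro x
    rw [← layer (p-1) hp1, ← lintegral_mul_const]
    · refine lintegral_congr fun t => ?_
      split_ifs <;> simp
    · exact Measurable.ite (measurableSet_lt (by fun_prop) (by fun_prop)) (by fun_prop) (by fun_prop)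
  calc ∫⁻ x, Mmu μ h x ^ p ∂μ 
      = ENNReal.ofReal p * ∫⁻ x, (∫⁻ t in Ioi (0:ℝ),
      (if ENNReal.ofReal t < Mmu μ h x then ENNReal.ofReal (t ^ (p - 1)) else 0)) ∂μ := by
        rw [← lintegral_const_mul' _ _ (by simp)]
        exact lintegral_congr e1
    _ = ENNReal.ofReal p * ∫⁻ t in Ioi (0:ℝ), ∫⁻ x, 
      (if ENNReal.ofReal t < Mmu μ h x then ENNReal.ofReal (t ^ (p - 1)) else 0) ∂μ := by
        rw [lintegral_lintegral_swap]
        apply Measurable.aemeasurable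
        exact Measurable.ite (measurableSet_lt (by fun_prop) (by fun_prop)) (by fun_prop) (by fun_prop)
    _ ≤ ENNReal.ofReal p * ∫⁻ t in Ioi (0:ℝ), 4 * ∫⁻ x,
      (if ENNReal.ofReal t < 2 * h x then ENNReal.ofReal (t ^ (p - 1 - 1)) * h x else 0) ∂μ := by
        gcongr ENNReal.ofReal p * ?_
        refine setLIntegral_mono' measurableSet_Ioi fun t ht => ?_
        have ht0 : 0 < t := ht
        have a1 : ∫⁻ x, (if ENNReal.ofReal t < Mmu μ h x then ENNReal.ofReal (t ^ (p - 1)) else 0) ∂μ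
            = ENNReal.ofReal (t ^ (p - 1)) * μ {x | ENNReal.ofReal t < Mmu μ h x} := by
          rw [← lintegral_indicator_const (measurableSet_lt measurable_const hMm)]
          refine lintegral_congr fun x => ?_
          simp [Set.indicator_apply]
        have a2 : ENNReal.ofReal (t ^ (p - 1)) = ENNReal.ofReal (t ^ (p-1-1)) * ENNReal.ofReal t := by
          rw [← ENNReal.ofReal_mul (by positivity)]
          congr 1
          rw [Real.rpow_sub_one ht0.ne' (p-1)]
          field_simp
        rw [a1, a2, mul_assoc]
        refine (mul_le_mul_right (weak2 μ h hm _ (by simp)) _).trans (le_of_eq ?_)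
        rw [mul_left_comm, ← lintegral_const_mul' _ _ (by simp)]
        congr 1
        refine lintegral_congr fun x => ?_
        split_ifs <;> simp
    _ = ENNReal.ofReal p * (4 * ∫⁻ x, (∫⁻ t in Ioi (0:ℝ),
      (if ENNReal.ofReal t < 2 * h x then ENNReal.ofReal (t ^ (p - 1 - 1)) * h x else 0)) ∂μ) := by
        rw [lintegral_const_mul' _ _ (by simp), lintegral_lintegral_swap]
        apply Measurable.aemeasurable
        exact Measurable.ite (measurableSet_lt (by fun_prop) (by fun_prop)) (by fun_prop) (by fun_prop)
    _ = ENNReal.ofReal p * (4 * ∫⁻ x, (ENNReal.ofReal (2 ^ (p-1) / (p-1))) * h x ^ p ∂μ) := by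
        congr 2
        refine lintegral_congr fun x => ?_
        rw [e2, ENNReal.mul_rpow_of_nonneg _ _ hp1.le, ENNReal.ofReal_div_of_pos hp1,
          ← ENNReal.ofReal_rpow_of_pos (by norm_num)]
        have : h x ^ p = h x ^ (p - 1) * h x := by
          conv_rhs => rw [← ENNReal.rpow_one (h x), ← ENNReal.rpow_mul, one_mul]
          rw [← ENNReal.rpow_add_of_nonneg _ _ hp1.le zero_le_one, sub_add_cancel]
        rw [this, div_eq_mul_inv, div_eq_mul_inv]
        norm_num
        ring
    _ = _ := by
        rw [lintegral_const_mul' _ _ (by simp), ← mul_assoc, ← mul_assoc]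
        congr 1
        rw [show (4:ℝ≥0∞) = ENNReal.ofReal 4 by norm_num, ← ENNReal.ofReal_mul (by positivity),
          ← ENNReal.ofReal_mul (by positivity)]
        congr 1
        ring


def Sc (r : ℝ) : ℝ := 4 * r * 2 ^ (r - 1) / (r - 1)

lemma Sc_pos {r : ℝ} (hr : 1 < r) : 0 < Sc r := by
  unfold Sc
  have : 0 < r - 1 := by linarith
  positivity

lemma ptwise (p : ℝ) (hp : 1 < p) (W S g : ℝ → ℝ≥0∞) (hW : Measurable W) (hS : Measurable S)
    (hg : Measurable g) (hW0 : ∀ t, W t ≠ 0) (hWt : ∀ t, W t ≠ ∞) (hS0 : ∀ t, S t ≠ 0)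
    (hSt : ∀ t, S t ≠ ∞) (A : ℝ≥0∞) (hA : A ≠ ∞)
    (hAp : ∀ a b : ℝ, a < b → (ENNReal.ofReal (b - a))⁻¹ * (∫⁻ t in Ioc a b, W t) *
      ((ENNReal.ofReal (b - a))⁻¹ * ∫⁻ t in Ioc a b, S t) ^ (p - 1) ≤ A) (x : ℝ) :
    Mmu volume g x ^ (p - 1) ≤ A * Mmu (volume.withDensity W)
      (fun y => Mmu (volume.withDensity S) (fun t => g t * (S t)⁻¹) y ^ (p - 1) * (W y)⁻¹) x := by
  have hp1 : 0 < p - 1 := by linarith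
  rw [← ENNReal.le_rpow_inv_iff hp1]
  refine iSup_le fun q => ?_
  by_cases hx : x ∈ Iq q
  swap
  · rw [Set.indicator_of_notMem hx]; exact zero_le
  rw [Set.indicator_of_mem hx, ENNReal.le_rpow_inv_iff hp1]
  have hab : (q.1 : ℝ) < q.2 := hx.1.trans_le hx.2
  have hL : volume (Iq q) = ENNReal.ofReal (q.2 - q.1) := by simp [Iq]
  have hL0 : volume (Iq q) ≠ 0 := by rw [hL]; simpa using hab
  have hLt : volume (Iq q) ≠ ∞ := by rw [hL]; simp
  set σ := volume.withDensity S with hσ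
  set ω := volume.withDensity W with hω
  have hA1 := hAp q.1 q.2 hab
  have eW : ω (Iq q) = ∫⁻ t in Ioc (q.1 : ℝ) q.2, W t := by
    rw [hω, withDensity_apply _ (Iq_meas q)]; rfl
  have eS : σ (Iq q) = ∫⁻ t in Ioc (q.1 : ℝ) q.2, S t := by
    rw [hσ, withDensity_apply _ (Iq_meas q)]; rfl
  rw [← hL, ← eW, ← eS] at hA1
  have pos : ∀ F : ℝ → ℝ≥0∞, Measurable F → (∀ t, F t ≠ 0) → volume.withDensity F (Iq q) ≠ 0 := by
    intro F hF hF0 h0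
    rw [withDensity_apply_eq_zero hF] at h0
    apply hL0
    convert h0 using 2
    ext t; simp [hF0]
  have hω0 : ω (Iq q) ≠ 0 := pos W hW hW0
  have hσ0 : σ (Iq q) ≠ 0 := pos S hS hS0
  have hLi0 : (volume (Iq q))⁻¹ ≠ 0 := by simpa using hLt
  have hLit : (volume (Iq q))⁻¹ ≠ ∞ := by simpa using hL0
  have hσt : σ (Iq q) ≠ ∞ := by
    intro h
    rw [h, ENNReal.mul_top hLi0, ENNReal.top_rpow_of_pos hp1,
      ENNReal.mul_top (mul_ne_zero hLi0 hω0)] at hA1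
    exact hA (top_le_iff.1 hA1)
  have hωt : ω (Iq q) ≠ ∞ := by
    intro h
    rw [h, ENNReal.mul_top hLi0, ENNReal.top_mul] at hA1
    · exact hA (top_le_iff.1 hA1)
    · simp only [ne_eq, ENNReal.rpow_eq_zero_iff, not_or, not_and]
      refine ⟨fun h => absurd h (mul_ne_zero hLi0 hσ0), fun h => absurd h ?_⟩
      exact ENNReal.mul_ne_top hLit hσt
  set h : ℝ → ℝ≥0∞ := fun t => g t * (S t)⁻¹ with hh
  have hhm : Measurable h := hg.mul hS.inv
  set B := (∫⁻ t in Iq q, h t ∂σ) / σ (Iq q) with hB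
  have eg : ∫⁻ t in Iq q, g t = B * σ (Iq q) := by
    rw [hB, ENNReal.div_mul_cancel hσ0 hσt, hσ, restrict_withDensity (Iq_meas q),
      lintegral_withDensity_eq_lintegral_mul _ hS hhm]
    refine lintegral_congr fun t => ?_
    simp only [Pi.mul_apply, hh]
    rw [mul_comm, mul_assoc, ENNReal.inv_mul_cancel (hS0 t) (hSt t), mul_one]
  have hφ : volume (Iq q) * B ^ (p-1) / ω (Iq q) ≤
      Mmu ω (fun y => Mmu σ h y ^ (p - 1) * (W y)⁻¹) x := by
    refine le_trans ?_ (le_Mmu ω _ hx)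
    gcongr
    have hφm : Measurable (fun y => Mmu σ h y ^ (p - 1) * (W y)⁻¹) :=
      ((Mmu_meas σ h).pow_const _).mul hW.inv
    rw [hω, restrict_withDensity (Iq_meas q),
      lintegral_withDensity_eq_lintegral_mul _ hW hφm]
    calc volume (Iq q) * B ^ (p-1) = ∫⁻ t in Iq q, B ^ (p-1) := by
          simp [mul_comm]
      _ ≤ _ := by
        refine setLIntegral_mono' (Iq_meas q) fun t ht => ?_
        simp only [Pi.mul_apply]
        rw [mul_comm, mul_assoc, ENNReal.inv_mul_cancel (hW0 t) (hWt t), mul_one]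
        gcongr
        exact le_Mmu σ h ht
  refine le_trans ?_ (mul_le_mul_right hφ A)
  calc ((∫⁻ t in Iq q, g t) / volume (Iq q)) ^ (p-1)
      = ((volume (Iq q))⁻¹ * σ (Iq q)) ^ (p-1) * B ^ (p-1) := by
        rw [eg, ← ENNReal.mul_rpow_of_nonneg _ _ hp1.le, div_eq_mul_inv]
        congr 1; ring
    _ = ((volume (Iq q))⁻¹ * ω (Iq q) * ((volume (Iq q))⁻¹ * σ (Iq q)) ^ (p-1)) *
        (volume (Iq q) * B ^ (p-1) / ω (Iq q)) := by
        rw [div_eq_mul_inv]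
        have e1 := ENNReal.inv_mul_cancel hL0 hLt
        have e2 := ENNReal.mul_inv_cancel hω0 hωt
        set X := ((volume (Iq q))⁻¹ * σ (Iq q)) ^ (p-1)
        calc X * B ^ (p-1) = X * B ^ (p-1) * (((volume (Iq q))⁻¹ * volume (Iq q)) * (ω (Iq q) * (ω (Iq q))⁻¹)) := by
              rw [e1, e2]; simp
          _ = _ := by ring
    _ ≤ _ := by gcongr

lemma buckley (p : ℝ) (hp : 1 < p) (u : ℝ → ℝ) (hu : Measurable u) (hu0 : ∀ t, 0 < u t)
    (A : ℝ≥0∞) (hA : A ≠ ∞) (hAp : apChar p u ≤ A) (g : ℝ → ℝ≥0∞) (hg : Measurable g) :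
    ∫⁻ x, Mmu volume g x ^ p * ENNReal.ofReal (u x) ≤
      ENNReal.ofReal (Sc (p / (p-1)) * Sc p) * A ^ (p / (p-1)) *
        ∫⁻ x, g x ^ p * ENNReal.ofReal (u x) := by
  have hp1 : 0 < p - 1 := by linarith
  have hp0 : 0 < p := by linarith
  set p' := p / (p - 1) with hp'
  have hp'1 : 1 < p' := by rw [hp', lt_div_iff₀ hp1]; linarith
  have hp'0 : 0 < p' := by linarith
  set W : ℝ → ℝ≥0∞ := fun t => ENNReal.ofReal (u t) with hWd
  set S : ℝ → ℝ≥0∞ := fun t => ENNReal.ofReal (u t ^ (1 - p')) with hSd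
  have hW : Measurable W := hu.ennreal_ofReal
  have hS : Measurable S := (hu.pow_const _).ennreal_ofReal
  have hW0 : ∀ t, W t ≠ 0 := fun t => by simpa [hWd] using hu0 t
  have hS0 : ∀ t, S t ≠ 0 := fun t => by simpa [hSd] using Real.rpow_pos_of_pos (hu0 t) _
  have hWt : ∀ t, W t ≠ ∞ := fun t => by simp [hWd]
  have hSt : ∀ t, S t ≠ ∞ := fun t => by simp [hSd]
  have eSW : ∀ t, S t = W t ^ (1 - p') := fun t => by
    simp only [hSd, hWd]; rw [ENNReal.ofReal_rpow_of_pos (hu0 t)]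
  have key := ptwise p hp W S g hW hS hg hW0 hWt hS0 hSt A hA (by
    intro a b hab
    refine le_trans ?_ hAp
    unfold apChar
    refine le_trans ?_ (le_iSup _ a)
    refine le_trans ?_ (le_iSup _ b)
    refine le_trans ?_ (le_iSup _ hab)
    exact le_rfl)
  set σ := volume.withDensity S with hσ
  set ω := volume.withDensity W with hω
  set h : ℝ → ℝ≥0∞ := fun t => g t * (S t)⁻¹ with hh
  have hhm : Measurable h := hg.mul hS.inv
  set φ : ℝ → ℝ≥0∞ := fun y => Mmu σ h y ^ (p - 1) * (W y)⁻¹ with hφ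
  have hφm : Measurable φ := ((Mmu_meas σ h).pow_const _).mul hW.inv
  have hpp : (p - 1) * p' = p := by rw [hp']; field_simp
  have hMle : ∀ x, Mmu volume g x ^ p ≤ A ^ p' * Mmu ω φ x ^ p' := by
    intro x
    have := ENNReal.rpow_le_rpow (key x) hp'0.le
    rwa [← ENNReal.rpow_mul, hpp, ENNReal.mul_rpow_of_nonneg _ _ hp'0.le] at this
  calc ∫⁻ x, Mmu volume g x ^ p * W x 
      ≤ ∫⁻ x, A ^ p' * (W x * Mmu ω φ x ^ p') := by
        refine lintegral_mono fun x => ?_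
        calc _ ≤ A ^ p' * Mmu ω φ x ^ p' * W x := by gcongr; exact hMle x
          _ = _ := by ring
    _ = A ^ p' * ∫⁻ x, Mmu ω φ x ^ p' ∂ω := by
        rw [lintegral_const_mul' _ _ (ENNReal.rpow_ne_top_of_nonneg hp'0.le hA), hω,
          lintegral_withDensity_eq_lintegral_mul _ hW ((Mmu_meas _ _).pow_const _)]
        rfl
    _ ≤ A ^ p' * (ENNReal.ofReal (Sc p') * ∫⁻ x, φ x ^ p' ∂ω) := by
        gcongr A ^ p' * ?_
        exact strong_type p' hp'1 ω φ hφm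
    _ = A ^ p' * (ENNReal.ofReal (Sc p') * ∫⁻ x, Mmu σ h x ^ p ∂σ) := by
        congr 2
        rw [hω, hσ, lintegral_withDensity_eq_lintegral_mul _ hW (hφm.pow_const _),
          lintegral_withDensity_eq_lintegral_mul _ hS ((Mmu_meas _ _).pow_const _)]
        refine lintegral_congr fun x => ?_
        simp only [Pi.mul_apply, hφ]
        rw [ENNReal.mul_rpow_of_nonneg _ _ hp'0.le, ← ENNReal.rpow_mul, hpp, eSW,
          sub_eq_add_neg, ENNReal.rpow_add _ _ (hW0 x) (hWt x), ENNReal.rpow_one,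
          ENNReal.inv_rpow, ENNReal.rpow_neg]
        ring
    _ ≤ A ^ p' * (ENNReal.ofReal (Sc p') * (ENNReal.ofReal (Sc p) * ∫⁻ x, h x ^ p ∂σ)) := by
        gcongr A ^ p' * (_ * ?_)
        exact strong_type p hp σ h hhm
    _ = A ^ p' * (ENNReal.ofReal (Sc p') * (ENNReal.ofReal (Sc p) * ∫⁻ x, g x ^ p * W x)) := by
        congr 3
        rw [hσ, lintegral_withDensity_eq_lintegral_mul _ hS (hhm.pow_const _)]
        refine lintegral_congr fun x => ?_
        simp only [Pi.mul_apply, hh]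
        have e : W x = S x ^ (1 - p) := by
          rw [eSW, ← ENNReal.rpow_mul]
          have : (1 - p') * (1 - p) = 1 := by rw [hp']; field_simp; ring
          rw [this, ENNReal.rpow_one]
        rw [ENNReal.mul_rpow_of_nonneg _ _ hp0.le, e,
          sub_eq_add_neg, ENNReal.rpow_add _ _ (hS0 x) (hSt x), ENNReal.rpow_one,
          ENNReal.inv_rpow, ENNReal.rpow_neg]
        ring
    _ = _ := by
        rw [ENNReal.ofReal_mul (Sc_pos hp'1).le]
        ring


section

variable {m : ℕ}

lemma mp_e (i : Fin (m+1)) : MeasurePreserving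
    (fun z : (Fin m → ℝ) × ℝ => (i.insertNth z.2 z.1 : Fin (m+1) → ℝ)) := by
  have h1 := (volume_preserving_piFinSuccAbove (fun _ : Fin (m + 1) => ℝ) i).symm
  have h2 := Measure.measurePreserving_swap (μ := (volume : Measure (Fin m → ℝ)))
    (ν := (volume : Measure ℝ))
  exact h1.comp h2

lemma qmp_rem (i : Fin (m+1)) : Measure.QuasiMeasurePreserving
    (fun x : Fin (m+1) → ℝ => i.removeNth x) := by
  have h1 := (volume_preserving_piFinSuccAbove (fun _ : Fin (m + 1) => ℝ) i)
  have h2 := Measure.quasiMeasurePreserving_snd (μ := (volume : Measure ℝ))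
    (ν := (volume : Measure (Fin m → ℝ)))
  exact h2.comp h1.quasiMeasurePreserving

lemma ae_slice (i : Fin (m+1)) {P : (Fin (m+1) → ℝ) → Prop} (h : ∀ᵐ x, P x) :
    ∀ᵐ y : Fin m → ℝ, ∀ᵐ t : ℝ, P (i.insertNth t y) :=
  Measure.ae_ae_of_ae_prod ((mp_e i).quasiMeasurePreserving.ae h)

lemma ae_update (i : Fin (m+1)) {P : (Fin (m+1) → ℝ) → Prop} (h : ∀ᵐ x, P x) :
    ∀ᵐ x : Fin (m+1) → ℝ, ∀ᵐ t : ℝ, P (Function.update x i t) := by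
  have := (qmp_rem i).ae (ae_slice i h)
  filter_upwards [this] with x hx
  filter_upwards [hx] with t ht
  rwa [Fin.insertNth_removeNth] at ht

lemma fubini (i : Fin (m+1)) (F : (Fin (m+1) → ℝ) → ℝ≥0∞) (hF : Measurable F) :
    ∫⁻ x, F x = ∫⁻ y : Fin m → ℝ, ∫⁻ t : ℝ, F (i.insertNth t y) := by
  rw [← (mp_e i).lintegral_comp hF]
  exact lintegral_prod _ (hF.comp (mp_e i).measurable).aemeasurable

def Mvar (i : Fin (m+1)) (g : (Fin (m+1) → ℝ) → ℝ≥0∞) (x : Fin (m+1) → ℝ) : ℝ≥0∞ :=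
  Mmu volume (fun t => g (Function.update x i t)) (x i)

lemma Mvar_meas (i : Fin (m+1)) (g : (Fin (m+1) → ℝ) → ℝ≥0∞) (hg : Measurable g) :
    Measurable (Mvar i g) := by
  unfold Mvar Mmu
  refine Measurable.iSup fun q => ?_
  have hu : Measurable (fun z : (Fin (m+1) → ℝ) × ℝ => Function.update z.1 i z.2) := by
    rw [measurable_pi_iff]
    intro j
    by_cases hj : j = i
    · subst hj; simpa using measurable_snd
    · simp only [Function.update_of_ne hj]; exact (measurable_pi_apply j).comp measurable_fst
  have h1 : Measurable (fun x : Fin (m+1) → ℝ => (∫⁻ t in Iq q, g (Function.update x i t)) / volume (Iq q)) :=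
    (Measurable.lintegral_prod_right' (hg.comp hu)).div_const _
  have h2 := h1.indicator ((Iq_meas q).preimage (measurable_pi_apply i))
  exact h2

lemma Mvar_bound (p : ℝ) (hp : 1 < p) (i : Fin (m+1)) (w : (Fin (m+1) → ℝ) → ℝ) (hw : Measurable w)
    (hw0 : ∀ x, 0 < w x) (hA : apVar p w i ≠ ∞) (g : (Fin (m+1) → ℝ) → ℝ≥0∞) (hg : Measurable g) :
    ∫⁻ x, Mvar i g x ^ p * ENNReal.ofReal (w x) ≤
      ENNReal.ofReal (Sc (p / (p-1)) * Sc p) * apVar p w i ^ (p / (p-1)) *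
        ∫⁻ x, g x ^ p * ENNReal.ofReal (w x) := by
  have hp0 : 0 < p - 1 := by linarith
  have m1 : Measurable (fun x => Mvar i g x ^ p * ENNReal.ofReal (w x)) :=
    ((Mvar_meas i g hg).pow_const _).mul hw.ennreal_ofReal
  have m2 : Measurable (fun x => g x ^ p * ENNReal.ofReal (w x)) :=
    (hg.pow_const _).mul hw.ennreal_ofReal
  rw [fubini i _ m1, fubini i _ m2, ← lintegral_const_mul']
  · apply lintegral_mono_ae
    have hae : ∀ᵐ x, apChar p (fun t => w (Function.update x i t)) ≤ apVar p w i := ae_le_essSup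
    filter_upwards [ae_slice i hae] with y hy
    obtain ⟨s, hs⟩ := hy.exists
    simp only [Fin.update_insertNth] at hs
    have hins : Measurable (fun t : ℝ => (i.insertNth t y : Fin (m+1) → ℝ)) :=
      (mp_e i).measurable.comp (measurable_const.prodMk measurable_id)
    have := buckley p hp _ (hw.comp hins) (fun t => hw0 _) _ hA hs _ (hg.comp hins)
    simpa [Mvar, Function.comp_def] using this
  · refine ENNReal.mul_ne_top (by simp) (ENNReal.rpow_ne_top_of_nonneg (by positivity) hA)

lemma iterate_bound (p : ℝ) (hp : 1 < p) (w : (Fin (m+1) → ℝ) → ℝ) (hw : Measurable w)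
    (hw0 : ∀ x, 0 < w x) (hA : ∀ i, apVar p w i ≠ ∞) (f : (Fin (m+1) → ℝ) → ℝ≥0∞)
    (hf : Measurable f) (s : Finset (Fin (m+1))) :
    ∃ g : (Fin (m+1) → ℝ) → ℝ≥0∞, Measurable g ∧
      (∀ (q : Fin (m+1) → ℚ × ℚ) (x : Fin (m+1) → ℝ), (∀ i, x i ∈ Iq (q i)) →
        (∫⋯∫⁻_s, f ∂(fun i => volume.restrict (Iq (q i)))) x ≤
          (∏ i ∈ s, volume (Iq (q i))) * g x) ∧
      ∫⁻ x, g x ^ p * ENNReal.ofReal (w x) ≤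
        (∏ i ∈ s, ENNReal.ofReal (Sc (p / (p-1)) * Sc p) * apVar p w i ^ (p / (p-1))) *
        ∫⁻ x, f x ^ p * ENNReal.ofReal (w x) := by
  classical
  induction s using Finset.induction_on with
  | empty => exact ⟨f, hf, fun q x _ => by simp, by simp⟩
  | insert i s hi ih =>
    obtain ⟨g, hg, h1, h2⟩ := ih
    refine ⟨Mvar i g, Mvar_meas i g hg, ?_, ?_⟩
    · intro q x hx
      rw [lmarginal_insert f hf hi, Finset.prod_insert hi]
      have hab : ((q i).1 : ℝ) < (q i).2 := (hx i).1.trans_le (hx i).2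
      have hL0 : volume (Iq (q i)) ≠ 0 := by simpa [Iq] using hab
      have hLt : volume (Iq (q i)) ≠ ∞ := by simp [Iq]
      calc _ ≤ ∫⁻ t in Iq (q i), (∏ j ∈ s, volume (Iq (q j))) * g (Function.update x i t) := by
            refine setLIntegral_mono' (Iq_meas _) fun t ht => h1 q _ ?_
            intro j
            by_cases hj : j = i
            · subst hj; simpa using ht
            · rw [Function.update_of_ne hj]; exact hx j
        _ = (∏ j ∈ s, volume (Iq (q j))) * (volume (Iq (q i)) *
            ((∫⁻ t in Iq (q i), g (Function.update x i t)) / volume (Iq (q i)))) := by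
            rw [lintegral_const_mul' _ _ (ENNReal.prod_ne_top fun j _ => by simp [Iq]),
              ENNReal.mul_div_cancel hL0 hLt]
        _ ≤ (∏ j ∈ s, volume (Iq (q j))) * (volume (Iq (q i)) * Mvar i g x) := by
            gcongr
            exact le_Mmu volume _ (hx i)
        _ = _ := by ring
    · rw [Finset.prod_insert hi, mul_assoc]
      exact (Mvar_bound p hp i w hw hw0 (hA i) g hg).trans (by gcongr)

/-- enlarge to rationals -/
lemma Ms_le (f : (Fin (m+1) → ℝ) → ℝ) (x : Fin (m+1) → ℝ) (F g : (Fin (m+1) → ℝ) → ℝ≥0∞)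
    (hF : ∀ s, ∫⁻ a in s, ENNReal.ofReal |f a| = ∫⁻ a in s, F a)
    (hg : ∀ (q : Fin (m+1) → ℚ × ℚ) (x : Fin (m+1) → ℝ), (∀ i, x i ∈ Iq (q i)) →
        (∫⋯∫⁻_Finset.univ, F ∂(fun i => volume.restrict (Iq (q i)))) x ≤
          (∏ i, volume (Iq (q i))) * g x) :
    Ms f x ≤ 2 ^ (m+1) * g x := by
  unfold Ms
  refine iSup_le fun a => iSup_le fun b => iSup_le fun hab => iSup_le fun hx => ?_
  have hq : ∀ i, ∃ q : ℚ × ℚ, Ioc (a i) (b i) ⊆ Iq q ∧ x i ∈ Iq q ∧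
      volume (Iq q) ≤ 2 * ENNReal.ofReal (b i - a i) := by
    intro i
    have := hab i
    obtain ⟨r, hr1, hr2⟩ := exists_rat_btwn (show a i - (b i - a i)/2 < a i by linarith)
    obtain ⟨s, hs1, hs2⟩ := exists_rat_btwn (show b i < b i + (b i - a i)/2 by linarith)
    refine ⟨(r, s), Ioc_subset_Ioc hr2.le hs1.le, ⟨hr2.trans_le (hx i).1, (hx i).2.trans hs1.le⟩, ?_⟩
    simp only [Iq, Real.volume_Ioc]
    rw [show (2:ℝ≥0∞) = ENNReal.ofReal 2 by simp, ← ENNReal.ofReal_mul (by norm_num)]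
    apply ENNReal.ofReal_le_ofReal
    linarith
  choose q hq1 hq2 hq3 using hq
  have hP0 : (∏ i, ENNReal.ofReal (b i - a i)) ≠ 0 := by
    rw [Finset.prod_ne_zero_iff]; intro i _; simpa using hab i
  have hPt : (∏ i, ENNReal.ofReal (b i - a i)) ≠ ∞ := ENNReal.prod_ne_top fun i _ => by simp
  rw [mul_comm, ← div_eq_mul_inv]
  apply ENNReal.div_le_of_le_mul
  calc ∫⁻ y in univ.pi (fun i => Ioc (a i) (b i)), ENNReal.ofReal |f y| 
      ≤ ∫⁻ y in univ.pi (fun i => Iq (q i)), ENNReal.ofReal |f y| :=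
        lintegral_mono_set (Set.pi_mono fun i _ => hq1 i)
    _ = ∫⁻ y in univ.pi (fun i => Iq (q i)), F y := hF _
    _ = (∫⋯∫⁻_Finset.univ, F ∂(fun i => volume.restrict (Iq (q i)))) x := by
        rw [volume_pi, Measure.restrict_pi_pi, lmarginal_univ]
    _ ≤ (∏ i, volume (Iq (q i))) * g x := hg q x hq2
    _ ≤ (∏ i, 2 * ENNReal.ofReal (b i - a i)) * g x := by
        gcongr with i; exact hq3 i
    _ = _ := by
        rw [Finset.prod_mul_distrib]; simp; ring

lemma apVar_congr (p : ℝ) (w w' : (Fin (m+1) → ℝ) → ℝ) (h : w =ᵐ[volume] w') (i : Fin (m+1)) :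
    apVar p w i = apVar p w' i := by
  unfold apVar
  apply essSup_congr_ae
  filter_upwards [ae_update i h] with x hx
  unfold apChar avgIoc lintIoc
  have e1 : ∀ a b : ℝ, ∫⁻ t in Ioc a b, ENNReal.ofReal (w (Function.update x i t)) =
      ∫⁻ t in Ioc a b, ENNReal.ofReal (w' (Function.update x i t)) := fun a b => by
    apply lintegral_congr_ae
    filter_upwards [ae_restrict_of_ae hx] with t ht
    rw [ht]
  have e2 : ∀ a b : ℝ, ∫⁻ t in Ioc a b, ENNReal.ofReal (w (Function.update x i t) ^ (1 - p/(p-1))) =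
      ∫⁻ t in Ioc a b, ENNReal.ofReal (w' (Function.update x i t) ^ (1 - p/(p-1))) := fun a b => by
    apply lintegral_congr_ae
    filter_upwards [ae_restrict_of_ae hx] with t ht
    rw [ht]
  simp only [e1, e2]

lemma part1 (n : ℕ) (hn : 0 < n) (p : ℝ) (hp : 1 < p) :
    ∃ c : ℝ, 0 < c ∧
      ∀ w : (Fin n → ℝ) → ℝ, IsWeightN w → (∀ i, apVar p w i ≠ ∞) →
        ∀ f : (Fin n → ℝ) → ℝ,
          lnormWN p w (Ms f) ≤
            ENNReal.ofReal c * (∏ i, apVar p w i) ^ (1 / (p - 1)) *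
              lnormWN p w (fun x => ENNReal.ofReal |f x|) := by
  obtain ⟨m, rfl⟩ : ∃ m, n = m + 1 := ⟨n - 1, by omega⟩
  have hp0 : 0 < p := by linarith
  have hp1 : 0 < p - 1 := by linarith
  have hp'1 : 1 < p / (p-1) := by rw [lt_div_iff₀ hp1]; linarith
  set K := Sc (p / (p-1)) * Sc p with hK
  have hK0 : 0 < K := mul_pos (Sc_pos hp'1) (Sc_pos hp)
  refine ⟨2 ^ (m+1) * (K ^ (m+1)) ^ (1/p), by positivity, ?_⟩
  intro w hw hA f
  obtain ⟨w1, hw1m, hw1⟩ := hw.2.aestronglyMeasurable.aemeasurable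
  set w' : (Fin (m+1) → ℝ) → ℝ := fun x => if 0 < w1 x then w1 x else 1 with hw'
  have hw'm : Measurable w' :=
    Measurable.ite (measurableSet_lt measurable_const hw1m) hw1m measurable_const
  have hw'0 : ∀ x, 0 < w' x := by
    intro x; simp only [hw']; split_ifs with h
    · exact h
    · norm_num
  have hww' : w =ᵐ[volume] w' := by
    filter_upwards [hw1, hw.1] with x h1 h2
    simp only [hw']
    rw [← h1, if_pos h2]
  have eA : ∀ i, apVar p w i = apVar p w' i := apVar_congr p w w' hww'
  have eN : ∀ g, lnormWN p w g = lnormWN p w' g := by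
    intro g
    unfold lnormWN
    congr 1
    apply lintegral_congr_ae
    filter_upwards [hww'] with x hx
    rw [hx]
  simp only [eA] at hA ⊢
  rw [eN, eN]
  obtain ⟨F, hFm, hFle, hF⟩ := exists_measurable_le_forall_setLIntegral_eq volume
    (fun x : Fin (m+1) → ℝ => ENNReal.ofReal |f x|)
  obtain ⟨g, hgm, h1, h2⟩ := iterate_bound p hp w' hw'm hw'0 hA F hFm Finset.univ
  have h3 : ∀ x, Ms f x ≤ 2 ^ (m+1) * g x := fun x => Ms_le f x F g hF h1
  unfold lnormWN
  have h4 : ∫⁻ x, Ms f x ^ p * ENNReal.ofReal (w' x) ≤ 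
      ((2 ^ (m+1) : ℝ≥0∞)) ^ p * ((ENNReal.ofReal (K ^ (m+1)) * (∏ i, apVar p w' i) ^ (p / (p-1))) *
        ∫⁻ x, ENNReal.ofReal |f x| ^ p * ENNReal.ofReal (w' x)) := by
    calc _ ≤ ∫⁻ x, ((2 ^ (m+1) : ℝ≥0∞)) ^ p * (g x ^ p * ENNReal.ofReal (w' x)) := by
          refine lintegral_mono fun x => ?_
          rw [← mul_assoc, ← ENNReal.mul_rpow_of_nonneg _ _ hp0.le]
          gcongr
          exact h3 x
      _ = ((2 ^ (m+1) : ℝ≥0∞)) ^ p * ∫⁻ x, (g x ^ p * ENNReal.ofReal (w' x)) := by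
          rw [lintegral_const_mul' _ _ (ENNReal.rpow_ne_top_of_nonneg hp0.le (by simp))]
      _ ≤ _ := by
          gcongr ((2 ^ (m+1) : ℝ≥0∞)) ^ p * ?_
          refine h2.trans ?_
          rw [Finset.prod_mul_distrib, ENNReal.prod_rpow_of_nonneg (by positivity)]
          gcongr with x
          · rw [ENNReal.ofReal_pow hK0.le]; simp [hK]
          · exact hFle x
  refine (ENNReal.rpow_le_rpow h4 (by positivity)).trans (le_of_eq ?_)
  have hip : 0 ≤ 1 / p := by positivity
  rw [ENNReal.mul_rpow_of_nonneg _ _ hip, ENNReal.mul_rpow_of_nonneg _ _ hip,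
    ENNReal.mul_rpow_of_nonneg _ _ hip, ← ENNReal.rpow_mul, ← ENNReal.rpow_mul,
    ENNReal.ofReal_mul (by positivity), ENNReal.ofReal_rpow_of_pos (by positivity)]
  rw [show p * (1/p) = 1 by field_simp, show p / (p-1) * (1/p) = 1/(p-1) by field_simp,
    ENNReal.rpow_one]
  simp only [← mul_assoc]
  congr 3
  rw [ENNReal.ofReal_pow (by norm_num)]
  simp

end


lemma two_prod (μ : Fin 2 → Measure ℝ) [∀ i, SigmaFinite (μ i)] (G0 G1 : ℝ → ℝ≥0∞)
    (h0 : Measurable G0) (h1 : Measurable G1) :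
    ∫⁻ x : Fin 2 → ℝ, G0 (x 0) * G1 (x 1) ∂Measure.pi μ = (∫⁻ t, G0 t ∂μ 0) * ∫⁻ t, G1 t ∂μ 1 := by
  have hm : Measurable (fun z : ℝ × ℝ => G0 z.1 * G1 z.2) := by fun_prop
  have := (measurePreserving_piFinTwo (α := fun _ : Fin 2 => ℝ) μ).lintegral_comp hm
  rw [← lintegral_prod_mul h0.aemeasurable h1.aemeasurable, ← this]
  rfl

lemma avg_le {u : ℝ → ℝ} {a b c : ℝ} (hab : a < b) (h : ∀ t ∈ Ioc a b, u t ≤ c) :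
    avgIoc u a b ≤ ENNReal.ofReal c := by
  unfold avgIoc lintIoc
  have hL0 : ENNReal.ofReal (b - a) ≠ 0 := by simpa using hab
  calc _ ≤ (ENNReal.ofReal (b - a))⁻¹ * ∫⁻ t in Ioc a b, ENNReal.ofReal c := by
        gcongr (ENNReal.ofReal (b - a))⁻¹ * ?_
        exact setLIntegral_mono' measurableSet_Ioc fun t ht => ENNReal.ofReal_le_ofReal (h t ht)
    _ = ENNReal.ofReal c := by
        rw [setLIntegral_const, Real.volume_Ioc, mul_left_comm, ENNReal.inv_mul_cancel hL0 (by simp),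
          mul_one]

lemma int_abs_pos (β R : ℝ) (hβ : -1 < β) (hR : 0 ≤ R) :
    ∫⁻ t in Ioc 0 R, ENNReal.ofReal (|t| ^ β) = ENNReal.ofReal (R ^ (β+1) / (β+1)) := by
  rw [← layer_fin (β+1) (by linarith) R hR]
  refine setLIntegral_congr_fun measurableSet_Ioc fun t ht => ?_
  simp only [add_sub_cancel_right]
  rw [abs_of_pos ht.1]

lemma int_abs (β R : ℝ) (hβ : -1 < β) (hR : 0 ≤ R) :
    ∫⁻ t in Ioc (-R) R, ENNReal.ofReal (|t| ^ β) ≤ 2 * ENNReal.ofReal (R ^ (β+1) / (β+1)) := by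
  have hm : Measurable (fun t : ℝ => ENNReal.ofReal (|t| ^ β)) := by fun_prop
  have h1 : ∫⁻ t in Icc (-R) 0, ENNReal.ofReal (|t| ^ β) = ENNReal.ofReal (R ^ (β+1) / (β+1)) := by
    have := (Measure.measurePreserving_neg (volume : Measure ℝ)).setLIntegral_comp_preimage
      (measurableSet_Icc (a := (0:ℝ)) (b := R)) hm
    simp only [abs_neg] at this
    rw [show (Neg.neg ⁻¹' Icc (0:ℝ) R) = Icc (-R) 0 by simp] at this
    rw [this, ← int_abs_pos β R hβ hR]
    exact setLIntegral_congr Ioc_ae_eq_Icc.symm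
  calc _ ≤ ∫⁻ t in Icc (-R) 0 ∪ Ioc 0 R, ENNReal.ofReal (|t| ^ β) := by
        apply lintegral_mono_set
        intro t ht
        rcases le_or_gt t 0 with h | h
        · exact Or.inl ⟨ht.1.le, h⟩
        · exact Or.inr ⟨h, ht.2⟩
    _ ≤ _ := by
        refine (lintegral_union_le _ _ _).trans ?_
        rw [h1, int_abs_pos β R hβ hR, two_mul]

lemma avg_near {β a b R : ℝ} (hβ : -1 < β) (hab : a < b) (hR : 0 < R) (ha : -R ≤ a) (hb : b ≤ R)
    (hL : R ≤ 2 * (b - a)) :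
    avgIoc (fun t => |t| ^ β) a b ≤ ENNReal.ofReal (4 * R ^ β / (β + 1)) := by
  unfold avgIoc lintIoc
  have hβ1 : 0 < β + 1 := by linarith
  have hL' : 0 < b - a := by linarith
  rw [mul_comm, ← div_eq_mul_inv]
  apply ENNReal.div_le_of_le_mul
  refine (lintegral_mono_set (Ioc_subset_Ioc ha hb)).trans ((int_abs β R hβ hR.le).trans ?_)
  rw [show (2:ℝ≥0∞) = ENNReal.ofReal 2 by simp, ← ENNReal.ofReal_mul (by norm_num),
    ← ENNReal.ofReal_mul (by positivity)]
  apply ENNReal.ofReal_le_ofReal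
  rw [Real.rpow_add_one hR.ne', div_mul_eq_mul_div, mul_div_assoc', div_le_div_iff_of_pos_right hβ1]
  have : 0 < R ^ β := by positivity
  nlinarith

section
variable (p ε : ℝ)

lemma sig_eq (hp : 1 < p) :
    (fun t : ℝ => (|t| ^ ((1 - ε) * (p - 1))) ^ (1 - p / (p - 1))) = fun t => |t| ^ (ε - 1) := by
  funext t
  rw [← Real.rpow_mul (abs_nonneg t)]
  congr 1
  have : p - 1 ≠ 0 := by linarith
  field_simp
  ring

lemma ap_lower (hp : 1 < p) (h0 : 0 < ε) (h1 : ε < 1) :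
    ENNReal.ofReal (p⁻¹ * (1/ε) ^ (p-1)) ≤ apChar p (fun t => |t| ^ ((1 - ε) * (p - 1))) := by
  have hp1 : 0 < p - 1 := by linarith
  unfold apChar
  refine le_trans ?_ (le_iSup _ (0:ℝ))
  refine le_trans ?_ (le_iSup _ (1:ℝ))
  refine le_trans ?_ (le_iSup _ zero_lt_one)
  rw [sig_eq p ε hp]
  unfold avgIoc lintIoc
  have hα : 0 < (1 - ε) * (p - 1) := mul_pos (by linarith) hp1
  rw [int_abs_pos _ _ (by linarith) zero_le_one, int_abs_pos _ _ (by linarith) zero_le_one]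
  simp only [sub_zero, ENNReal.ofReal_one, inv_one, one_mul, Real.one_rpow, sub_add_cancel]
  rw [ENNReal.ofReal_rpow_of_pos (by positivity), ← ENNReal.ofReal_mul (by positivity)]
  apply ENNReal.ofReal_le_ofReal
  gcongr
  rw [← one_div]
  apply one_div_le_one_div_of_le (by positivity)
  nlinarith

lemma ap_upper (hp : 1 < p) (h0 : 0 < ε) (h1 : ε < 1) :
    apChar p (fun t => |t| ^ ((1 - ε) * (p - 1))) ≤ ENNReal.ofReal (4 ^ p * (1/ε) ^ (p-1)) := by
  have hp1 : 0 < p - 1 := by linarith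
  have hα : 0 < (1 - ε) * (p - 1) := mul_pos (by linarith) hp1
  set α := (1 - ε) * (p - 1) with hαd
  unfold apChar
  refine iSup_le fun a => iSup_le fun b => iSup_le fun hab => ?_
  rw [hαd, sig_eq p ε hp, ← hαd]
  set R := max |a| |b| with hRd
  have hRa : |a| ≤ R := le_max_left _ _
  have hRb : |b| ≤ R := le_max_right _ _
  have ha1 := abs_le.1 hRa
  have hb1 := abs_le.1 hRb
  have hR : 0 < R := by linarith [ha1.1, hb1.2]
  have hαe : (ε - 1) * (p - 1) = -α := by rw [hαd]; ring
  by_cases hL : R ≤ 2 * (b - a)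
  · have e1 := avg_near (β := α) (by linarith) hab hR ha1.1 hb1.2 hL
    have e2 := avg_near (β := ε - 1) (by linarith) hab hR ha1.1 hb1.2 hL
    refine (mul_le_mul' e1 (ENNReal.rpow_le_rpow e2 hp1.le)).trans ?_
    rw [sub_add_cancel, ENNReal.ofReal_rpow_of_pos (by positivity),
      ← ENNReal.ofReal_mul (by positivity)]
    apply ENNReal.ofReal_le_ofReal
    have e3 : 4 * R ^ α / (α + 1) ≤ 4 * R ^ α := div_le_self (by positivity) (by linarith)
    calc 4 * R ^ α / (α + 1) * (4 * R ^ (ε - 1) / ε) ^ (p - 1) 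
        ≤ 4 * R ^ α * (4 * R ^ (ε - 1) / ε) ^ (p - 1) := by gcongr
      _ = 4 * R ^ α * (4 ^ (p-1) * R ^ (-α) * (1/ε) ^ (p-1)) := by
          rw [div_eq_mul_one_div, Real.mul_rpow (by positivity) (by positivity),
            Real.mul_rpow (by positivity) (by positivity), ← Real.rpow_mul hR.le, hαe]
      _ = (4 * 4 ^ (p-1)) * (R ^ α * R ^ (-α)) * (1/ε) ^ (p-1) := by ring
      _ = 4 ^ p * (1/ε) ^ (p-1) := by
          rw [← Real.rpow_add hR, add_neg_cancel, Real.rpow_zero, mul_one,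
            Real.rpow_sub_one (by norm_num)]
          ring
      _ ≤ _ := le_rfl
  · push Not at hL
    have hlow : ∀ t ∈ Ioc a b, R / 2 ≤ |t| ∧ |t| ≤ R := by
      intro t ht
      refine ⟨?_, abs_le.2 ⟨by linarith [ht.1], by linarith [ht.2]⟩⟩
      rcases max_choice |a| |b| with h | h
      · have e1 : R = |a| := h
        have e2 : |a| - |t| ≤ |a - t| := abs_sub_abs_le_abs_sub a t
        have e3 : |a - t| ≤ b - a := abs_le.2 ⟨by linarith [ht.2], by linarith [ht.1]⟩
        linarith
      · have e1 : R = |b| := h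
        have e2 : |b| - |t| ≤ |b - t| := abs_sub_abs_le_abs_sub b t
        have e3 : |b - t| ≤ b - a := abs_le.2 ⟨by linarith [ht.2], by linarith [ht.1]⟩
        linarith
    have e1 : avgIoc (fun t => |t| ^ α) a b ≤ ENNReal.ofReal (R ^ α) :=
      avg_le hab fun t ht => Real.rpow_le_rpow (abs_nonneg _) (hlow t ht).2 hα.le
    have e2 : avgIoc (fun t => |t| ^ (ε - 1)) a b ≤ ENNReal.ofReal ((R/2) ^ (ε - 1)) :=
      avg_le hab fun t ht => Real.rpow_le_rpow_of_nonpos (by positivity) (hlow t ht).1 (by linarith)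
    refine (mul_le_mul' e1 (ENNReal.rpow_le_rpow e2 hp1.le)).trans ?_
    rw [ENNReal.ofReal_rpow_of_pos (by positivity),
      ← ENNReal.ofReal_mul (by positivity)]
    apply ENNReal.ofReal_le_ofReal
    rw [← Real.rpow_mul (by positivity), hαe, Real.rpow_neg (by positivity),
      Real.div_rpow hR.le (by norm_num), inv_div, mul_div_cancel₀ _ (by positivity)]
    calc (2:ℝ) ^ α ≤ 2 ^ p := Real.rpow_le_rpow_of_exponent_le (by norm_num) (by
            rw [hαd]; nlinarith)
      _ ≤ 4 ^ p := Real.rpow_le_rpow (by norm_num) (by norm_num) (by linarith)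
      _ ≤ 4 ^ p * (1/ε) ^ (p-1) := by
          apply le_mul_of_one_le_right (by positivity)
          apply Real.one_le_rpow _ hp1.le
          rw [le_div_iff₀ h0]; linarith

lemma ap_scale (hp : 1 < p) (u : ℝ → ℝ) (hu : ∀ t, 0 ≤ u t) (c : ℝ) (hc : 0 < c) :
    apChar p (fun t => c * u t) = apChar p u := by
  have hp1 : 0 < p - 1 := by linarith
  have e1 : ∀ (k : ℝ) (v : ℝ → ℝ) (a b : ℝ), 0 ≤ k →
      avgIoc (fun t => k * v t) a b = ENNReal.ofReal k * avgIoc v a b := by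
    intro k v a b hk
    unfold avgIoc lintIoc
    simp only [ENNReal.ofReal_mul hk]
    rw [lintegral_const_mul' _ _ ENNReal.ofReal_ne_top, mul_left_comm]
  unfold apChar
  refine iSup_congr fun a => iSup_congr fun b => iSup_congr fun hab => ?_
  have e2 : (fun t => (c * u t) ^ (1 - p/(p-1))) = fun t => c ^ (1 - p/(p-1)) * u t ^ (1 - p/(p-1)) := by
    funext t; rw [Real.mul_rpow hc.le (hu t)]
  rw [e2, e1 _ _ _ _ hc.le, e1 _ _ _ _ (by positivity), ENNReal.mul_rpow_of_nonneg _ _ hp1.le,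
    ENNReal.ofReal_rpow_of_pos (by positivity), ← Real.rpow_mul hc.le,
    show (1 - p/(p-1)) * (p-1) = -1 by field_simp; ring, Real.rpow_neg_one, mul_mul_mul_comm,
    ← ENNReal.ofReal_mul hc.le, mul_inv_cancel₀ hc.ne', ENNReal.ofReal_one, one_mul]

lemma apVar_w (hp : 1 < p) (α : ℝ) (i : Fin 2) :
    apVar p (fun x : Fin 2 → ℝ => |x 0| ^ α * |x 1| ^ α) i = apChar p (fun t => |t| ^ α) := by
  unfold apVar
  have : (fun x : Fin 2 → ℝ => apChar p (fun t =>
      |(Function.update x i t) 0| ^ α * |(Function.update x i t) 1| ^ α)) =ᵐ[volume]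
      fun _ => apChar p (fun t => |t| ^ α) := by
    have h0 : ∀ᵐ x : Fin 2 → ℝ, x 0 ≠ 0 := Measure.ae_eval_ne (μ := fun _ : Fin 2 => (volume : Measure ℝ)) 0 (0:ℝ)
    have h1 : ∀ᵐ x : Fin 2 → ℝ, x 1 ≠ 0 := Measure.ae_eval_ne (μ := fun _ : Fin 2 => (volume : Measure ℝ)) 1 (0:ℝ)
    filter_upwards [h0, h1] with x hx0 hx1
    fin_cases i
    · simp only [Fin.zero_eta, Function.update_self, Fin.mk_one]
      rw [← ap_scale p hp (fun t => |t| ^ α) (fun t => by positivity) (|x 1| ^ α) (by positivity)]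
      simp [mul_comm]
    · simp only [Fin.mk_one, Function.update_self]
      rw [← ap_scale p hp (fun t => |t| ^ α) (fun t => by positivity) (|x 0| ^ α) (by positivity)]
      simp
  rw [essSup_congr_ae this, essSup_const']

lemma sq_const (hp : 1 < p) (h0 : 0 < ε) (B : ℝ) (hB : 0 < B) :
    (ENNReal.ofReal (B * (1/ε) ^ (p-1)) * ENNReal.ofReal (B * (1/ε) ^ (p-1))) ^ (1 / (p-1))
      = ENNReal.ofReal ((B * B) ^ (1/(p-1)) / ε ^ 2) := by
  have hp1 : 0 < p - 1 := by linarith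
  rw [← ENNReal.ofReal_mul (by positivity), ENNReal.ofReal_rpow_of_pos (by positivity)]
  congr 1
  rw [mul_mul_mul_comm, Real.mul_rpow (by positivity) (by positivity),
    Real.mul_rpow (x := (1/ε)^(p-1)) (by positivity) (by positivity), ← Real.rpow_mul (by positivity),
    show (p-1) * (1/(p-1)) = 1 by field_simp, Real.rpow_one]
  field_simp

def gf (t : ℝ) : ℝ := (Ioc (0:ℝ) 1).indicator (fun t => t ^ (ε - 1)) t

lemma gf_meas : Measurable (gf ε) :=
  (measurable_id.pow_const _).indicator measurableSet_Ioc

lemma gf_nonneg (t : ℝ) : 0 ≤ gf ε t :=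
  Set.indicator_nonneg (fun t ht => Real.rpow_nonneg ht.1.le _) t

lemma gf_int (h0 : 0 < ε) (x : ℝ) (hx0 : 0 < x) (hx1 : x ≤ 1) :
    ∫⁻ t in Ioc 0 x, ENNReal.ofReal (gf ε t) = ENNReal.ofReal (x ^ ε / ε) := by
  rw [← layer_fin ε h0 x hx0.le]
  refine setLIntegral_congr_fun measurableSet_Ioc fun t ht => ?_
  simp only [gf]
  rw [Set.indicator_of_mem (show t ∈ Ioc (0:ℝ) 1 from ⟨ht.1, ht.2.trans hx1⟩)]

lemma gf_norm (hp : 1 < p) (h0 : 0 < ε) :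
    ∫⁻ t, ENNReal.ofReal (gf ε t) ^ p * ENNReal.ofReal (|t| ^ ((1 - ε) * (p-1))) = ENNReal.ofReal (1 / ε) := by
  have : (fun t => ENNReal.ofReal (gf ε t) ^ p * ENNReal.ofReal (|t| ^ ((1 - ε) * (p-1)))) =
      (Ioc (0:ℝ) 1).indicator (fun t => ENNReal.ofReal (t ^ (ε - 1))) := by
    funext t
    unfold gf
    by_cases ht : t ∈ Ioc (0:ℝ) 1
    · rw [Set.indicator_of_mem ht, Set.indicator_of_mem ht]
      have ht0 := ht.1
      rw [ENNReal.ofReal_rpow_of_pos (by positivity), ← ENNReal.ofReal_mul (by positivity),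
        abs_of_pos ht0, ← Real.rpow_mul ht0.le, ← Real.rpow_add ht0]
      congr 2
      ring
    · rw [Set.indicator_of_notMem ht, Set.indicator_of_notMem ht]
      simp [ENNReal.zero_rpow_of_pos (show 0 < p by linarith)]
  rw [this, lintegral_indicator measurableSet_Ioc, layer_fin ε h0 1 zero_le_one, Real.one_rpow]

lemma Ms_gf (h0 : 0 < ε) (x : Fin 2 → ℝ) :
    ENNReal.ofReal (1 / ε ^ 2) * ENNReal.ofReal |gf ε (x 0) * gf ε (x 1)| ≤
      Ms (fun x : Fin 2 → ℝ => gf ε (x 0) * gf ε (x 1)) x := by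
  by_cases hx : x 0 ∈ Ioc (0:ℝ) 1 ∧ x 1 ∈ Ioc (0:ℝ) 1
  swap
  · have : gf ε (x 0) * gf ε (x 1) = 0 := by
      unfold gf
      rcases not_and_or.1 hx with h | h <;> simp [Set.indicator_of_notMem h]
    simp [this]
  obtain ⟨⟨ha0, ha1⟩, hb0, hb1⟩ := hx
  have hpos : ∀ i : Fin 2, 0 < x i := by intro i; fin_cases i <;> assumption
  unfold Ms
  refine le_trans ?_ (le_iSup _ (fun _ => (0:ℝ)))
  refine le_trans ?_ (le_iSup _ x)
  refine le_trans ?_ (le_iSup _ hpos)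
  refine le_trans ?_ (le_iSup _ (fun i => ⟨(hpos i).le, le_rfl⟩))
  have e : ∫⁻ y in univ.pi (fun i => Ioc (0:ℝ) (x i)), ENNReal.ofReal |gf ε (y 0) * gf ε (y 1)|
      = ENNReal.ofReal ((x 0) ^ ε / ε) * ENNReal.ofReal ((x 1) ^ ε / ε) := by
    rw [← gf_int ε h0 _ ha0 ha1, ← gf_int ε h0 _ hb0 hb1, volume_pi, Measure.restrict_pi_pi,
      ← two_prod (fun i => volume.restrict (Ioc 0 (x i))) _ _ (gf_meas ε).ennreal_ofReal
        (gf_meas ε).ennreal_ofReal]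
    refine lintegral_congr fun y => ?_
    rw [abs_of_nonneg (mul_nonneg (gf_nonneg _ _) (gf_nonneg _ _)), ENNReal.ofReal_mul (gf_nonneg _ _)]
  rw [e]
  simp only [Fin.prod_univ_two, sub_zero]
  rw [← ENNReal.ofReal_mul ha0.le, ← ENNReal.ofReal_inv_of_pos (by positivity),
    ← ENNReal.ofReal_mul (by positivity), ← ENNReal.ofReal_mul (by positivity),
    ← ENNReal.ofReal_mul (by positivity), abs_of_nonneg (mul_nonneg (gf_nonneg _ _) (gf_nonneg _ _))]
  apply ENNReal.ofReal_le_ofReal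
  unfold gf
  rw [Set.indicator_of_mem (show x 0 ∈ Ioc (0:ℝ) 1 from ⟨ha0, ha1⟩),
    Set.indicator_of_mem (show x 1 ∈ Ioc (0:ℝ) 1 from ⟨hb0, hb1⟩),
    Real.rpow_sub_one ha0.ne', Real.rpow_sub_one hb0.ne']
  apply le_of_eq
  field_simp

lemma part2 (hp : 1 < p) :
    (∃ c₁ c₂ c₃ : ℝ, 0 < c₁ ∧ 0 < c₂ ∧ 0 < c₃ ∧
      ∀ ε : ℝ, ε ∈ Set.Ioo (0 : ℝ) 1 →
        let w : (Fin 2 → ℝ) → ℝ := fun x =>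
          |x 0| ^ ((1 - ε) * (p - 1)) * |x 1| ^ ((1 - ε) * (p - 1))
        ENNReal.ofReal (c₁ / ε ^ 2) ≤ (apVar p w 0 * apVar p w 1) ^ (1 / (p - 1)) ∧
        (apVar p w 0 * apVar p w 1) ^ (1 / (p - 1)) ≤ ENNReal.ofReal (c₂ / ε ^ 2) ∧
        ∃ f : (Fin 2 → ℝ) → ℝ,
          lnormWN p w (fun x => ENNReal.ofReal |f x|) ≠ 0 ∧
          lnormWN p w (fun x => ENNReal.ofReal |f x|) ≠ ∞ ∧
          ENNReal.ofReal (c₃ / ε ^ 2) * lnormWN p w (fun x => ENNReal.ofReal |f x|) ≤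
            lnormWN p w (Ms f)) := by
  have hp0 : 0 < p := by linarith
  have hp1 : 0 < p - 1 := by linarith
  refine ⟨(p⁻¹ * p⁻¹) ^ (1/(p-1)), (4 ^ p * 4 ^ p) ^ (1/(p-1)), 1, by positivity, by positivity,
    one_pos, ?_⟩
  rintro ε ⟨h0, h1⟩
  intro w
  have eV : ∀ i, apVar p w i = apChar p (fun t => |t| ^ ((1 - ε) * (p - 1))) :=
    apVar_w p hp ((1 - ε) * (p - 1))
  rw [eV, eV, ← sq_const p ε hp h0 _ (by positivity), ← sq_const p ε hp h0 _ (by positivity)]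
  have hl := ap_lower p ε hp h0 h1
  have hu := ap_upper p ε hp h0 h1
  refine ⟨ENNReal.rpow_le_rpow (mul_le_mul' hl hl) (by positivity),
    ENNReal.rpow_le_rpow (mul_le_mul' hu hu) (by positivity),
    fun x => gf ε (x 0) * gf ε (x 1), ?_⟩
  have eN : ∫⁻ x : Fin 2 → ℝ, ENNReal.ofReal |gf ε (x 0) * gf ε (x 1)| ^ p * ENNReal.ofReal (w x)
      = ENNReal.ofReal (1/ε) * ENNReal.ofReal (1/ε) := by
    have hm : Measurable (fun t => ENNReal.ofReal (gf ε t) ^ p *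
        ENNReal.ofReal (|t| ^ ((1 - ε) * (p-1)))) := by
      have := gf_meas ε
      fun_prop
    rw [← gf_norm p ε hp h0, ← two_prod (fun _ => volume) _ _ hm hm, ← volume_pi]
    refine lintegral_congr fun x => ?_
    rw [abs_of_nonneg (mul_nonneg (gf_nonneg _ _) (gf_nonneg _ _)), ENNReal.ofReal_mul (gf_nonneg _ _),
      ENNReal.mul_rpow_of_nonneg _ _ hp0.le, ENNReal.ofReal_mul (by positivity)]
    ring
  have hip : 0 < 1 / p := by positivity
  refine ⟨?_, ?_, ?_⟩
  · unfold lnormWN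
    rw [eN, ← ENNReal.ofReal_mul (by positivity), ENNReal.ofReal_rpow_of_pos (by positivity)]
    simp only [ne_eq, ENNReal.ofReal_eq_zero, not_le]
    positivity
  · unfold lnormWN
    rw [eN]
    exact ENNReal.rpow_ne_top_of_nonneg hip.le (by simp [ENNReal.mul_eq_top])
  · unfold lnormWN
    have e : ∀ c : ℝ≥0∞, c = (c ^ p) ^ (1/p) := fun c => by
      rw [← ENNReal.rpow_mul, show p * (1/p) = 1 by field_simp, ENNReal.rpow_one]
    rw [e (ENNReal.ofReal (1 / ε ^ 2)), ← ENNReal.mul_rpow_of_nonneg _ _ hip.le,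
      ← lintegral_const_mul' _ _ (ENNReal.rpow_ne_top_of_nonneg hp0.le (by simp))]
    refine ENNReal.rpow_le_rpow (lintegral_mono fun x => ?_) hip.le
    simp only
    rw [← mul_assoc, ← ENNReal.mul_rpow_of_nonneg _ _ hp0.le]
    gcongr
    exact Ms_gf ε h0 x
end

/-- Sharp mixed bound for the strong maximal operator:
`‖M^{(s)}f‖_{L^p_w} ≤ c (∏ᵢ ‖w‖_{A_p(x_i)})^{1/(p-1)} ‖f‖_{L^p_w}`, and the power
`1/(p-1)` is sharp: for `n = 2`, `w(x₁,x₂) = |x₁|^{(1-ε)(p-1)}|x₂|^{(1-ε)(p-1)}`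
has `(‖w‖_{A_p(x_1)}‖w‖_{A_p(x_2)})^{1/(p-1)} ≍ ε⁻²` and there is `f ∈ L^p_w` with
`‖M^{(s)}f‖_{L^p_w} ≥ c ε⁻² ‖f‖_{L^p_w}`. -/
theorem stmt16 (n : ℕ) (hn : 0 < n) (p : ℝ) (hp : 1 < p) :
    (∃ c : ℝ, 0 < c ∧
      ∀ w : (Fin n → ℝ) → ℝ, IsWeightN w → (∀ i, apVar p w i ≠ ∞) →
        ∀ f : (Fin n → ℝ) → ℝ,
          lnormWN p w (Ms f) ≤
            ENNReal.ofReal c * (∏ i, apVar p w i) ^ (1 / (p - 1)) *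
              lnormWN p w (fun x => ENNReal.ofReal |f x|)) ∧
    (∃ c₁ c₂ c₃ : ℝ, 0 < c₁ ∧ 0 < c₂ ∧ 0 < c₃ ∧
      ∀ ε : ℝ, ε ∈ Set.Ioo (0 : ℝ) 1 →
        let w : (Fin 2 → ℝ) → ℝ := fun x =>
          |x 0| ^ ((1 - ε) * (p - 1)) * |x 1| ^ ((1 - ε) * (p - 1))
        ENNReal.ofReal (c₁ / ε ^ 2) ≤ (apVar p w 0 * apVar p w 1) ^ (1 / (p - 1)) ∧
        (apVar p w 0 * apVar p w 1) ^ (1 / (p - 1)) ≤ ENNReal.ofReal (c₂ / ε ^ 2) ∧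
        ∃ f : (Fin 2 → ℝ) → ℝ,
          lnormWN p w (fun x => ENNReal.ofReal |f x|) ≠ 0 ∧
          lnormWN p w (fun x => ENNReal.ofReal |f x|) ≠ ∞ ∧
          ENNReal.ofReal (c₃ / ε ^ 2) * lnormWN p w (fun x => ENNReal.ofReal |f x|) ≤
            lnormWN p w (Ms f)) := by
  exact ⟨part1 n hn p hp, part2 p hp⟩

end
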